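/- arXiv:1609.00832 — 5 statements merged into one kernel-verified Lean document; each statement's English description precedes it below -/
import Mathlib

section
/- Let d ≥ 1, γ > 0 and A ≥ γ, and let N be an ℝ^d-valued random vector with density p_γ (isotropic Cauchy of scale γ). Consider the additive channel Y = X + N with X independent of N. (i) Converse: for every X with E[ln(1+‖X‖)] < ∞ such that there exists P ∈ [γ, A] with E[ln(1+‖Y‖²/P²)] = c_d (i.e., the 1-power of the output satisfies γ ≤ P₁(Y) ≤ A), one has h(Y) − h(N) ≤ d·ln(A/γ). (ii) Achievability: if A > γ and X has density p_{A−γ}, then Y = X + N has density p_A, the output constraint is met with P = A, and h(Y) − h(N) = d·ln(A/γ). Hence the capacity of the additive isotropic Cauchy noise channel under the output 1-power constraint P₁(Y) ≤ A equals d·ln(A/γ). -/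
open MeasureTheory ProbabilityTheory Real Filter Topology

/-- The standard `d`-dimensional isotropic Cauchy density. -/
noncomputable def pC (d : ℕ) (x : EuclideanSpace ℝ (Fin d)) : ℝ :=
  Real.Gamma (((d : ℝ) + 1) / 2) * Real.pi ^ (-((d : ℝ) + 1) / 2) *
    (1 + ‖x‖ ^ 2) ^ (-((d : ℝ) + 1) / 2)

/-- The isotropic Cauchy density with scale `γ`. -/
noncomputable def pGam (d : ℕ) (γ : ℝ) (x : EuclideanSpace ℝ (Fin d)) : ℝ :=
  γ ^ (-(d : ℝ)) * pC d (γ⁻¹ • x)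

/-- The logarithmic moment `c_d` of the standard isotropic Cauchy density. -/
noncomputable def cD (d : ℕ) : ℝ :=
  ∫ x : EuclideanSpace ℝ (Fin d), pC d x * Real.log (1 + ‖x‖ ^ 2)

/-- Differential entropy of a density on `ℝ^d` (natural logarithm). -/
noncomputable def dEnt {d : ℕ} (f : EuclideanSpace ℝ (Fin d) → ℝ) : ℝ :=
  -∫ x, f x * Real.log (f x)

lemma integral_exp_neg_mul_cosh_mul_exp_half {c : ℝ} (hc : 0 < c) :
    ∫ s : ℝ, √c * (rexp (-(2 * c * cosh s)) * rexp (s / 2)) = √π * rexp (-(2 * c)) := by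
  have hsc : 0 < √c := Real.sqrt_pos.2 hc
  have hderiv : ∀ s : ℝ, HasDerivAt (fun s => 2 * √c * sinh (s / 2)) (√c * cosh (s / 2)) s := by
    intro s
    have h := ((hasDerivAt_id s).div_const 2).sinh.const_mul (2 * √c)
    refine h.congr_deriv ?_
    simp only [id]
    ring
  have hinj : Function.Injective (fun s : ℝ => 2 * √c * sinh (s / 2)) := by
    intro a b hab
    have h1 : sinh (a / 2) = sinh (b / 2) := mul_left_cancel₀ (by positivity) hab
    have h2 := Real.sinh_injective h1
    linarith
  have himage : (fun s : ℝ => 2 * √c * sinh (s / 2)) '' Set.univ = Set.univ := by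
    rw [Set.image_univ, Set.range_eq_univ]
    intro w
    refine ⟨2 * arsinh (w / (2 * √c)), ?_⟩
    simp only
    rw [mul_div_cancel_left₀ _ (two_ne_zero), Real.sinh_arsinh]
    field_simp
  have hpt : ∀ s : ℝ, |√c * cosh (s / 2)| • rexp (-1 * (2 * √c * sinh (s / 2)) ^ 2)
      = rexp (2 * c) * (√c * (rexp (-(2 * c * cosh s)) * cosh (s / 2))) := by
    intro s
    have hcs : cosh s = 1 + 2 * sinh (s / 2) ^ 2 := by
      have h := Real.cosh_two_mul (s / 2)
      rw [Real.cosh_sq, mul_div_cancel₀ _ (two_ne_zero)] at h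
      linarith
    rw [abs_of_pos (by have := Real.cosh_pos (s / 2); positivity), smul_eq_mul, mul_pow, mul_pow,
      Real.sq_sqrt hc.le, hcs]
    have : rexp (-1 * (2 ^ 2 * c * sinh (s / 2) ^ 2))
        = rexp (2 * c) * rexp (-(2 * c * (1 + 2 * sinh (s / 2) ^ 2))) := by
      rw [← Real.exp_add]
      ring_nf
    rw [this]
    ring
  have hG := integral_gaussian 1
  have hI := integrable_exp_neg_mul_sq (b := 1) one_pos
  have hsub := integral_image_eq_integral_abs_deriv_smul MeasurableSet.univ
    (fun x _ => (hderiv x).hasDerivWithinAt) hinj.injOn (fun w : ℝ => rexp (-1 * w ^ 2))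
  have hsubI := integrableOn_image_iff_integrableOn_abs_deriv_smul MeasurableSet.univ
    (fun x _ => (hderiv x).hasDerivWithinAt) hinj.injOn (fun w : ℝ => rexp (-1 * w ^ 2))
  rw [himage] at hsub hsubI
  simp only [hpt, setIntegral_univ, integrableOn_univ] at hsub hsubI
  rw [hG, integral_const_mul, div_one] at hsub
  have hcosh : Integrable (fun s : ℝ => √c * (rexp (-(2 * c * cosh s)) * cosh (s / 2))) := by
    have := (hsubI.1 hI).const_mul (rexp (-(2 * c)))
    refine this.congr (ae_of_all _ fun s => ?_)
    simp only
    rw [← mul_assoc, ← Real.exp_add]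
    simp
  have hexp : Integrable (fun s : ℝ => √c * (rexp (-(2 * c * cosh s)) * rexp (s / 2))) := by
    refine (hcosh.const_mul 2).mono' (by fun_prop) (ae_of_all _ fun s => ?_)
    rw [Real.norm_of_nonneg (by positivity), Real.cosh_eq (s / 2)]
    have h1 : 0 < rexp (-(s / 2)) := Real.exp_pos _
    have h2 : 0 < √c * rexp (-(2 * c * cosh s)) := by positivity
    nlinarith
  have hneg : ∫ s : ℝ, √c * (rexp (-(2 * c * cosh s)) * rexp (-(s / 2)))
      = ∫ s : ℝ, √c * (rexp (-(2 * c * cosh s)) * rexp (s / 2)) := by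
    rw [← integral_neg_eq_self]
    simp [neg_div]
  have hexp' : Integrable (fun s : ℝ => √c * (rexp (-(2 * c * cosh s)) * rexp (-(s / 2)))) := by
    have := hexp.comp_neg
    simpa [neg_div] using this
  have havg : ∫ s : ℝ, √c * (rexp (-(2 * c * cosh s)) * cosh (s / 2))
      = ∫ s : ℝ, √c * (rexp (-(2 * c * cosh s)) * rexp (s / 2)) := by
    have h := integral_add hexp hexp'
    rw [hneg] at h
    have h2 : ∫ s : ℝ, √c * (rexp (-(2 * c * cosh s)) * rexp (s / 2)) +
        √c * (rexp (-(2 * c * cosh s)) * rexp (-(s / 2)))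
        = 2 * ∫ s : ℝ, √c * (rexp (-(2 * c * cosh s)) * cosh (s / 2)) := by
      rw [← integral_const_mul]
      congr 1 with s
      rw [Real.cosh_eq (s / 2)]
      ring
    linarith
  rw [← havg, hsub, mul_comm (rexp (2 * c)), mul_assoc, ← Real.exp_add]
  simp

lemma integral_rpow_neg_half_mul_exp_neg_add_div {c : ℝ} (hc : 0 ≤ c) :
    ∫ u in Set.Ioi (0 : ℝ), u ^ (-1 / 2 : ℝ) * rexp (-(u + c ^ 2 / u)) = √π * rexp (-(2 * c)) := by
  rcases hc.eq_or_lt with rfl | hc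
  · have h := Real.integral_rpow_mul_exp_neg_mul_Ioi (a := 1 / 2) (r := 1) (by norm_num) one_pos
    rw [Real.Gamma_one_half_eq] at h
    norm_num at h ⊢
    exact h
  rw [← integral_exp_neg_mul_cosh_mul_exp_half hc]
  have himage : (fun s : ℝ => c * rexp s) '' Set.univ = Set.Ioi 0 := by
    ext u
    constructor
    · rintro ⟨s, -, rfl⟩
      exact mul_pos hc (Real.exp_pos s)
    · intro hu
      refine ⟨Real.log (u / c), trivial, ?_⟩
      simp only
      rw [Real.exp_log (div_pos hu hc)]
      field_simp
  have hsub := integral_image_eq_integral_abs_deriv_smul MeasurableSet.univ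
    (fun x _ => ((Real.hasDerivAt_exp x).const_mul c).hasDerivWithinAt)
    (fun a _ b _ hab => Real.exp_injective (mul_left_cancel₀ hc.ne' hab))
    (fun u : ℝ => u ^ (-1 / 2 : ℝ) * rexp (-(u + c ^ 2 / u)))
  rw [himage] at hsub
  rw [hsub, setIntegral_univ]
  congr 1 with s
  rw [abs_of_pos (by positivity), smul_eq_mul, Real.mul_rpow hc.le (Real.exp_pos _).le,
    ← Real.exp_mul]
  have h1 : c * rexp s + c ^ 2 / (c * rexp s) = 2 * c * cosh s := by
    rw [Real.cosh_eq, Real.exp_neg]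
    field_simp
  have h2 : c * c ^ (-1 / 2 : ℝ) = √c := by
    rw [Real.sqrt_eq_rpow]
    nth_rewrite 1 [← Real.rpow_one c]
    rw [← Real.rpow_add hc]
    norm_num
  have h3 : rexp s * rexp (s * (-1 / 2)) = rexp (s / 2) := by
    rw [← Real.exp_add]
    ring_nf
  rw [h1, ← h2, ← h3]
  ring

lemma integrable_one_add_norm_sq_rpow {d : ℕ} {r : ℝ} (hr : r < -(d : ℝ) / 2) :
    Integrable (fun x : EuclideanSpace ℝ (Fin d) => (1 + ‖x‖ ^ 2) ^ r) := by
  have h := integrable_rpow_neg_one_add_norm_sq (E := EuclideanSpace ℝ (Fin d)) (μ := volume)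
    (r := -2 * r) (by rw [finrank_euclideanSpace_fin]; linarith)
  convert h using 3
  ring

lemma pC_pos (d : ℕ) (x : EuclideanSpace ℝ (Fin d)) : 0 < pC d x := by
  have := Real.Gamma_pos_of_pos (s := ((d : ℝ) + 1) / 2) (by positivity)
  unfold pC
  positivity

lemma continuous_pC (d : ℕ) : Continuous (pC d) := by
  unfold pC
  refine continuous_const.mul (Continuous.rpow_const (by fun_prop) fun x => Or.inl ?_)
  positivity

lemma integrable_pC (d : ℕ) : Integrable (pC d) := by
  unfold pC
  exact (integrable_one_add_norm_sq_rpow (by linarith)).const_mul _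

lemma integral_rpow_mul_exp_neg_one_add_norm_sq {d : ℕ} (x : EuclideanSpace ℝ (Fin d)) :
    ∫ u in Set.Ioi (0 : ℝ), u ^ (((d : ℝ) + 1) / 2 - 1) * rexp (-((1 + ‖x‖ ^ 2) * u))
      = π ^ (((d : ℝ) + 1) / 2) * pC d x := by
  have h0 : 0 < 1 + ‖x‖ ^ 2 := by positivity
  rw [Real.integral_rpow_mul_exp_neg_mul_Ioi (by positivity) h0, pC, one_div,
    Real.inv_rpow h0.le, ← Real.rpow_neg h0.le, neg_div, Real.rpow_neg pi_pos.le]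
  have : π ^ (((d : ℝ) + 1) / 2) ≠ 0 := by positivity
  field_simp

lemma integral_pC_mul_cexp (d : ℕ) (t : EuclideanSpace ℝ (Fin d)) :
    ∫ x : EuclideanSpace ℝ (Fin d), (pC d x : ℂ) * Complex.exp ((inner ℝ x t : ℝ) * Complex.I)
      = (rexp (-‖t‖) : ℝ) := by
  set a : ℝ := ((d : ℝ) + 1) / 2 with ha
  have ha0 : 0 < a := by positivity
  let G : EuclideanSpace ℝ (Fin d) → ℝ → ℝ :=
    fun x u => u ^ (a - 1) * rexp (-((1 + ‖x‖ ^ 2) * u))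
  let F : EuclideanSpace ℝ (Fin d) → ℝ → ℂ :=
    fun x u => (G x u : ℂ) * Complex.exp ((inner ℝ x t : ℝ) * Complex.I)
  have hnorm : ∀ x, ∀ u ∈ Set.Ioi (0 : ℝ), ‖F x u‖ = G x u := by
    intro x u hu
    have hu0 : (0 : ℝ) < u := hu
    simp only [F, norm_mul, Complex.norm_exp_ofReal_mul_I, mul_one, Complex.norm_real]
    exact Real.norm_of_nonneg (by positivity)
  have hFmeas : Measurable (Function.uncurry F) := by
    simp only [F, G, Function.uncurry_def]
    fun_prop
  have hGint : ∀ x, IntegrableOn (G x) (Set.Ioi 0) := by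
    intro x
    have h := integrableOn_rpow_mul_exp_neg_mul_rpow (p := 1) (s := a - 1) (b := 1 + ‖x‖ ^ 2)
      (by linarith) one_pos (by positivity)
    simpa only [Real.rpow_one, neg_mul] using h
  have hFint : Integrable (Function.uncurry F) (volume.prod (volume.restrict (Set.Ioi 0))) := by
    rw [integrable_prod_iff hFmeas.aestronglyMeasurable]
    constructor
    · refine ae_of_all _ fun x => ?_
      refine (hGint x).mono' (hFmeas.comp measurable_prodMk_left).aestronglyMeasurable ?_
      filter_upwards [ae_restrict_mem measurableSet_Ioi] with u hu
      exact (hnorm x u hu).le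
    · refine ((integrable_pC d).const_mul (π ^ a)).congr (ae_of_all _ fun x => ?_)
      simp only
      rw [← integral_rpow_mul_exp_neg_one_add_norm_sq]
      exact (setIntegral_congr_fun measurableSet_Ioi (hnorm x)).symm
  have hleft : ∀ x, ∫ u in Set.Ioi (0 : ℝ), F x u
      = ((π ^ a : ℝ) : ℂ) * ((pC d x : ℂ) * Complex.exp ((inner ℝ x t : ℝ) * Complex.I)) := by
    intro x
    simp only [F, G]
    rw [integral_mul_const, integral_complex_ofReal, integral_rpow_mul_exp_neg_one_add_norm_sq]
    push_cast
    ring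
  have hright : ∀ u ∈ Set.Ioi (0 : ℝ), ∫ x, F x u
      = ((π ^ ((d : ℝ) / 2) * (u ^ (-1 / 2 : ℝ) * rexp (-(u + (‖t‖ / 2) ^ 2 / u))) : ℝ) : ℂ) := by
    intro u hu
    have hu0 : (0 : ℝ) < u := hu
    have h := GaussianFourier.integral_cexp_neg_mul_sq_norm_add (b := (u : ℂ))
      (by simpa using hu0) Complex.I t
    rw [finrank_euclideanSpace_fin] at h
    have hF : ∀ x, F x u = ((u ^ (a - 1) * rexp (-u) : ℝ) : ℂ) *
        Complex.exp (-(u : ℂ) * (‖x‖ : ℂ) ^ 2 + Complex.I * (inner ℝ t x : ℝ)) := by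
      intro x
      simp only [F, G]
      rw [real_inner_comm, Complex.exp_add, mul_comm Complex.I, ← mul_assoc]
      congr 1
      push_cast
      rw [mul_assoc, ← Complex.exp_add]
      ring_nf
    simp_rw [hF]
    rw [integral_const_mul, h]
    have h1 : ((π : ℂ) / (u : ℂ)) ^ ((d : ℂ) / 2)
        = ((π ^ ((d : ℝ) / 2) * u ^ (-((d : ℝ) / 2)) : ℝ) : ℂ) := by
      rw [Real.rpow_neg hu0.le, ← div_eq_mul_inv, ← Real.div_rpow pi_pos.le hu0.le,
        Complex.ofReal_cpow (by positivity)]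
      push_cast
      rfl
    have h2 : Complex.exp (Complex.I ^ 2 * (‖t‖ : ℂ) ^ 2 / (4 * (u : ℂ)))
        = ((rexp (-((‖t‖ / 2) ^ 2 / u)) : ℝ) : ℂ) := by
      push_cast
      rw [Complex.I_sq]
      congr 1
      ring
    have h3 : u ^ (-1 / 2 : ℝ) = u ^ (a - 1) * u ^ (-((d : ℝ) / 2)) := by
      rw [← Real.rpow_add hu0, ha]
      congr 1
      ring
    rw [h1, h2, neg_add, Real.exp_add, h3]
    push_cast
    ring
  have hswap := integral_integral_swap hFint
  rw [setIntegral_congr_fun measurableSet_Ioi hright] at hswap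
  simp_rw [hleft] at hswap
  rw [integral_const_mul, integral_complex_ofReal, integral_const_mul,
    integral_rpow_neg_half_mul_exp_neg_add_div (by positivity)] at hswap
  have hpi : ((π ^ a : ℝ) : ℂ) ≠ 0 := by
    exact_mod_cast (Real.rpow_pos_of_pos pi_pos a).ne'
  apply mul_left_cancel₀ hpi
  rw [hswap, Real.sqrt_eq_rpow, ← mul_assoc, ← Real.rpow_add pi_pos, ha, ← add_div,
    mul_div_cancel₀ _ two_ne_zero]
  push_cast
  rfl

lemma pGam_pos (d : ℕ) {γ : ℝ} (hγ : 0 < γ) (x : EuclideanSpace ℝ (Fin d)) : 0 < pGam d γ x :=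
  mul_pos (Real.rpow_pos_of_pos hγ _) (pC_pos d _)

lemma continuous_pGam (d : ℕ) (γ : ℝ) : Continuous (pGam d γ) :=
  continuous_const.mul ((continuous_pC d).comp (continuous_const_smul _))

lemma integrable_pGam (d : ℕ) {γ : ℝ} (hγ : 0 < γ) : Integrable (pGam d γ) :=
  ((integrable_pC d).comp_smul (inv_ne_zero hγ.ne')).const_mul _

lemma exists_pGam_le (d : ℕ) {γ : ℝ} (hγ : 0 < γ) : ∃ M, 0 < M ∧ ∀ x, pGam d γ x ≤ M := by
  refine ⟨γ ^ (-(d : ℝ)) * pC d 0, mul_pos (Real.rpow_pos_of_pos hγ _) (pC_pos d _), fun x => ?_⟩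
  unfold pGam
  gcongr
  have hG := Real.Gamma_pos_of_pos (s := ((d : ℝ) + 1) / 2) (by positivity)
  unfold pC
  gcongr ?_ * ?_
  rw [norm_zero]
  apply Real.rpow_le_rpow_of_nonpos (by norm_num)
  · gcongr
    simp
  · have : (0 : ℝ) ≤ d := Nat.cast_nonneg d
    linarith

lemma integral_pGam_smul_comp {F : Type*} [NormedAddCommGroup F] [NormedSpace ℝ F] (d : ℕ) {γ : ℝ}
    (hγ : 0 < γ) (g : EuclideanSpace ℝ (Fin d) → F) :
    ∫ x, pGam d γ x • g (γ⁻¹ • x) = ∫ x, pC d x • g x := by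
  have h := Measure.integral_comp_inv_smul volume (fun x => pC d x • g x) γ
  rw [finrank_euclideanSpace_fin, abs_of_pos (by positivity)] at h
  simp only [pGam, mul_smul]
  rw [integral_smul, h, smul_smul, Real.rpow_neg hγ.le, Real.rpow_natCast,
    inv_mul_cancel₀ (by positivity), one_smul]

lemma integral_pC (d : ℕ) : ∫ x, pC d x = 1 := by
  have h := integral_pC_mul_cexp d 0
  simp only [inner_zero_right, Complex.ofReal_zero, zero_mul, Complex.exp_zero, mul_one, norm_zero,
    neg_zero, Real.exp_zero] at h
  rw [integral_complex_ofReal] at h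
  exact_mod_cast h

lemma integral_pGam (d : ℕ) {γ : ℝ} (hγ : 0 < γ) : ∫ x, pGam d γ x = 1 := by
  have h := integral_pGam_smul_comp d hγ (fun _ => (1 : ℝ))
  simpa [integral_pC] using h

lemma integrable_pC_mul_log (d : ℕ) :
    Integrable (fun x : EuclideanSpace ℝ (Fin d) => pC d x * Real.log (1 + ‖x‖ ^ 2)) := by
  have hint := (integrable_one_add_norm_sq_rpow (d := d) (r := -((d : ℝ) + 1) / 2 + 1 / 4)
    (by linarith)).const_mul
    (Real.Gamma (((d : ℝ) + 1) / 2) * π ^ (-((d : ℝ) + 1) / 2) * 4)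
  have hmeas : Measurable (fun x : EuclideanSpace ℝ (Fin d) => pC d x * Real.log (1 + ‖x‖ ^ 2)) :=
    (continuous_pC d).measurable.mul (Real.measurable_log.comp (by fun_prop))
  refine hint.mono' hmeas.aestronglyMeasurable (ae_of_all _ fun x => ?_)
  have h1 : (1 : ℝ) ≤ 1 + ‖x‖ ^ 2 := by simp
  have h0 : (0 : ℝ) < 1 + ‖x‖ ^ 2 := by positivity
  rw [Real.norm_of_nonneg (mul_nonneg (pC_pos d x).le (Real.log_nonneg h1))]
  have hlog := Real.log_le_rpow_div h0.le (ε := 1 / 4) (by norm_num)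
  calc pC d x * Real.log (1 + ‖x‖ ^ 2)
      ≤ pC d x * ((1 + ‖x‖ ^ 2) ^ (1 / 4 : ℝ) / (1 / 4)) :=
        mul_le_mul_of_nonneg_left hlog (pC_pos d x).le
    _ = _ := by
        rw [Real.rpow_add h0, pC]
        ring

lemma norm_inv_smul_sq {d : ℕ} {γ : ℝ} (x : EuclideanSpace ℝ (Fin d)) :
    ‖γ⁻¹ • x‖ ^ 2 = ‖x‖ ^ 2 / γ ^ 2 := by
  rw [norm_smul, mul_pow, norm_inv, Real.norm_eq_abs, inv_pow, sq_abs]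
  ring

lemma integrable_pGam_mul_log (d : ℕ) {γ : ℝ} (hγ : 0 < γ) :
    Integrable (fun x => pGam d γ x * Real.log (1 + ‖x‖ ^ 2 / γ ^ 2)) := by
  have h := ((integrable_pC_mul_log d).comp_smul (inv_ne_zero hγ.ne')).const_mul (γ ^ (-(d : ℝ)))
  refine h.congr (ae_of_all _ fun x => ?_)
  simp only [norm_inv_smul_sq, pGam]
  ring

lemma integral_pGam_mul_log (d : ℕ) {γ : ℝ} (hγ : 0 < γ) :
    ∫ x, pGam d γ x * Real.log (1 + ‖x‖ ^ 2 / γ ^ 2) = cD d := by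
  have h := integral_pGam_smul_comp d hγ (fun x => Real.log (1 + ‖x‖ ^ 2))
  simp only [norm_inv_smul_sq, smul_eq_mul] at h
  exact h

lemma cD_pos {d : ℕ} (hd : 1 ≤ d) : 0 < cD d := by
  have hcont : Continuous
      (fun x : EuclideanSpace ℝ (Fin d) => pC d x * Real.log (1 + ‖x‖ ^ 2)) :=
    (continuous_pC d).mul (Continuous.log (by fun_prop) fun x => by positivity)
  have hlog : ∀ x : EuclideanSpace ℝ (Fin d), 0 ≤ Real.log (1 + ‖x‖ ^ 2) := fun x =>
    Real.log_nonneg (by simp)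
  have : Nonempty (Fin d) := ⟨⟨0, hd⟩⟩
  obtain ⟨x, hx⟩ := exists_ne (0 : EuclideanSpace ℝ (Fin d))
  refine integral_pos_of_integrable_nonneg_nonzero hcont (integrable_pC_mul_log d)
    (fun x => mul_nonneg (pC_pos d x).le (hlog x)) (x := x) ?_
  have hx' : 0 < ‖x‖ := norm_pos_iff.2 hx
  exact (mul_pos (pC_pos d x) (Real.log_pos (lt_add_of_pos_right _ (pow_pos hx' 2)))).ne'

lemma log_pGam (d : ℕ) {γ : ℝ} (hγ : 0 < γ) (x : EuclideanSpace ℝ (Fin d)) :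
    Real.log (pGam d γ x) = -(d * Real.log γ)
      + Real.log (Real.Gamma (((d : ℝ) + 1) / 2) * π ^ (-((d : ℝ) + 1) / 2))
      - ((d : ℝ) + 1) / 2 * Real.log (1 + ‖x‖ ^ 2 / γ ^ 2) := by
  have hG := Real.Gamma_pos_of_pos (s := ((d : ℝ) + 1) / 2) (by positivity)
  have h0 : 0 < 1 + ‖x‖ ^ 2 / γ ^ 2 := by positivity
  rw [pGam, pC, norm_inv_smul_sq, Real.log_mul (by positivity) (by positivity),
    Real.log_mul (by positivity) (by positivity), Real.log_rpow hγ, Real.log_rpow h0]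
  ring

/-- The integral of the logarithm of a Cauchy density against a density with the matching
logarithmic moment. -/
lemma integral_mul_log_pGam (d : ℕ) {γ : ℝ} (hγ : 0 < γ) {f : EuclideanSpace ℝ (Fin d) → ℝ}
    (hf : Integrable f) (hf1 : ∫ x, f x = 1)
    (hlog : Integrable (fun x => f x * Real.log (1 + ‖x‖ ^ 2 / γ ^ 2)))
    (hc : ∫ x, f x * Real.log (1 + ‖x‖ ^ 2 / γ ^ 2) = cD d) :
    Integrable (fun x => f x * Real.log (pGam d γ x)) ∧
    ∫ x, f x * Real.log (pGam d γ x) = -(d * Real.log γ)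
      + Real.log (Real.Gamma (((d : ℝ) + 1) / 2) * π ^ (-((d : ℝ) + 1) / 2))
      - ((d : ℝ) + 1) / 2 * cD d := by
  set K := -(d * Real.log γ)
    + Real.log (Real.Gamma (((d : ℝ) + 1) / 2) * π ^ (-((d : ℝ) + 1) / 2)) with hK
  have heq : (fun x => f x * Real.log (pGam d γ x)) = fun x =>
      K * f x - ((d : ℝ) + 1) / 2 * (f x * Real.log (1 + ‖x‖ ^ 2 / γ ^ 2)) := by
    ext x
    rw [log_pGam d hγ]
    ring
  rw [heq]
  refine ⟨(hf.const_mul _).sub (hlog.const_mul _), ?_⟩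
  rw [integral_sub (hf.const_mul _) (hlog.const_mul _), integral_const_mul, integral_const_mul,
    hf1, hc, mul_one]

lemma dEnt_pGam (d : ℕ) {γ : ℝ} (hγ : 0 < γ) :
    dEnt (pGam d γ) = d * Real.log γ
      - Real.log (Real.Gamma (((d : ℝ) + 1) / 2) * π ^ (-((d : ℝ) + 1) / 2))
      + ((d : ℝ) + 1) / 2 * cD d := by
  rw [dEnt, (integral_mul_log_pGam d hγ (integrable_pGam d hγ) (integral_pGam d hγ)
    (integrable_pGam_mul_log d hγ) (integral_pGam_mul_log d hγ)).2]
  ring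

lemma dEnt_pGam_sub (d : ℕ) {γ A : ℝ} (hγ : 0 < γ) (hA : 0 < A) :
    dEnt (pGam d A) - dEnt (pGam d γ) = d * Real.log (A / γ) := by
  rw [dEnt_pGam d hγ, dEnt_pGam d hA, Real.log_div hA.ne' hγ.ne']
  ring

/-- Among bounded positive densities with a given logarithmic moment, the Cauchy density maximizes
the entropy. -/
lemma dEnt_le_dEnt_pGam (d : ℕ) {P M : ℝ} (hP : 0 < P) {f : EuclideanSpace ℝ (Fin d) → ℝ}
    (hfm : Measurable f) (hf0 : ∀ᵐ x, 0 < f x) (hfM : ∀ᵐ x, f x ≤ M) (hf : Integrable f)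
    (hf1 : ∫ x, f x = 1) (hlog : Integrable (fun x => f x * Real.log (1 + ‖x‖ ^ 2 / P ^ 2)))
    (hc : ∫ x, f x * Real.log (1 + ‖x‖ ^ 2 / P ^ 2) = cD d) :
    dEnt f ≤ dEnt (pGam d P) := by
  obtain ⟨hI, hval⟩ := integral_mul_log_pGam d hP hf hf1 hlog hc
  have hp := integrable_pGam d hP
  have hlow : ∀ᵐ x, f x * Real.log (pGam d P x) + f x - pGam d P x ≤ f x * Real.log (f x) := by
    filter_upwards [hf0] with x hx
    have hpx := pGam_pos d hP x
    have h := Real.log_le_sub_one_of_pos (div_pos hpx hx)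
    rw [Real.log_div hpx.ne' hx.ne'] at h
    have h2 := mul_le_mul_of_nonneg_left h hx.le
    have h3 : f x * (pGam d P x / f x - 1) = pGam d P x - f x := by field_simp
    rw [h3] at h2
    linarith
  have hlowI : Integrable (fun x => f x * Real.log (pGam d P x) + f x - pGam d P x) :=
    (hI.add hf).sub hp
  have hent : Integrable (fun x => f x * Real.log (f x)) := by
    refine ((hlowI.norm).add ((hf.const_mul (Real.log M)).norm)).mono'
      (hfm.mul hfm.log).aestronglyMeasurable ?_
    filter_upwards [hlow, hf0, hfM] with x h1 h2 h3
    have h4 : f x * Real.log (f x) ≤ Real.log M * f x := by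
      rw [mul_comm]
      exact mul_le_mul_of_nonneg_right (Real.log_le_log h2 h3) h2.le
    simp only [Pi.add_apply, Real.norm_eq_abs]
    refine abs_le.2 ⟨?_, ?_⟩
    · have := neg_abs_le (f x * Real.log (pGam d P x) + f x - pGam d P x)
      have := abs_nonneg (Real.log M * f x)
      linarith
    · have := abs_nonneg (f x * Real.log (pGam d P x) + f x - pGam d P x)
      have := le_abs_self (Real.log M * f x)
      linarith
  have hle := integral_mono_ae hlowI hent hlow
  have hsum : ∫ x, (f x * Real.log (pGam d P x) + f x - pGam d P x)
      = ∫ x, f x * Real.log (pGam d P x) := by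
    rw [integral_sub (f := fun x => f x * Real.log (pGam d P x) + f x) (hI.add hf) hp,
      integral_add hI hf, hf1, integral_pGam d hP, add_sub_cancel_right]
  rw [hsum, hval] at hle
  rw [dEnt_pGam d hP, dEnt]
  linarith

lemma isProbabilityMeasure_withDensity_pGam (d : ℕ) {γ : ℝ} (hγ : 0 < γ) :
    IsProbabilityMeasure (volume.withDensity (fun x => ENNReal.ofReal (pGam d γ x))) := by
  constructor
  rw [withDensity_apply _ MeasurableSet.univ, Measure.restrict_univ,
    ← ofReal_integral_eq_lintegral_ofReal (integrable_pGam d hγ)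
      (ae_of_all _ fun x => (pGam_pos d hγ x).le), integral_pGam d hγ, ENNReal.ofReal_one]

lemma integral_withDensity_ofReal {E F : Type*} [MeasurableSpace E] [NormedAddCommGroup F]
    [NormedSpace ℝ F] {ν : Measure E} {f : E → ℝ} (hf : Measurable f) (hf0 : ∀ᵐ x ∂ν, 0 ≤ f x)
    (g : E → F) :
    ∫ x, g x ∂(ν.withDensity fun x => ENNReal.ofReal (f x)) = ∫ x, f x • g x ∂ν := by
  rw [integral_withDensity_eq_integral_toReal_smul hf.ennreal_ofReal
    (ae_of_all _ fun _ => ENNReal.ofReal_lt_top)]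
  refine integral_congr_ae ?_
  filter_upwards [hf0] with x hx
  rw [ENNReal.toReal_ofReal hx]

lemma charFun_withDensity_pGam (d : ℕ) {γ : ℝ} (hγ : 0 < γ) (t : EuclideanSpace ℝ (Fin d)) :
    charFun (volume.withDensity (fun x => ENNReal.ofReal (pGam d γ x))) t
      = (rexp (-(γ * ‖t‖)) : ℝ) := by
  rw [charFun_apply, integral_withDensity_ofReal (continuous_pGam d γ).measurable
    (ae_of_all _ fun x => (pGam_pos d hγ x).le)]
  have h := integral_pGam_smul_comp d hγ
    (fun x => Complex.exp ((inner ℝ x (γ • t) : ℝ) * Complex.I))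
  have h2 := integral_pC_mul_cexp d (γ • t)
  simp only [Complex.real_smul] at h ⊢
  rw [h2, norm_smul, Real.norm_of_nonneg hγ.le] at h
  rw [← h]
  congr 1 with x
  rw [real_inner_smul_left, real_inner_smul_right, inv_mul_cancel_left₀ hγ.ne']

lemma withDensity_pGam_conv (d : ℕ) {a b : ℝ} (ha : 0 < a) (hb : 0 < b) :
    (volume.withDensity fun x => ENNReal.ofReal (pGam d a x)) ∗
      (volume.withDensity fun x => ENNReal.ofReal (pGam d b x))
      = volume.withDensity fun x => ENNReal.ofReal (pGam d (a + b) x) := by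
  have := isProbabilityMeasure_withDensity_pGam d ha
  have := isProbabilityMeasure_withDensity_pGam d hb
  have := isProbabilityMeasure_withDensity_pGam d (add_pos ha hb)
  apply Measure.ext_of_charFun
  ext t
  rw [charFun_conv, charFun_withDensity_pGam d ha, charFun_withDensity_pGam d hb,
    charFun_withDensity_pGam d (add_pos ha hb), ← Complex.ofReal_mul, ← Real.exp_add]
  ring_nf

lemma conv_apply_eq_lintegral {G : Type*} [AddMonoid G] [MeasurableSpace G] [MeasurableAdd₂ G]
    (ρ ν : Measure G) [SFinite ν] {s : Set G} (hs : MeasurableSet s) :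
    (ρ.conv ν) s = ∫⁻ x, ν ((fun y => x + y) ⁻¹' s) ∂ρ := by
  rw [← lintegral_indicator_one hs, Measure.lintegral_conv (measurable_one.indicator hs)]
  refine lintegral_congr fun x => ?_
  rw [← lintegral_indicator_one (hs.preimage (measurable_const_add x))]
  rfl

lemma ae_measure_preimage_eq_zero_of_conv_eq_zero {G : Type*} [AddMonoid G] [MeasurableSpace G]
    [MeasurableAdd₂ G] (ρ ν : Measure G) [SFinite ν] {s : Set G} (hs : MeasurableSet s)
    (h : (ρ.conv ν) s = 0) : ∀ᵐ x ∂ρ, ν ((fun y => x + y) ⁻¹' s) = 0 := by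
  have hmeas : Measurable fun x => ν ((fun y => x + y) ⁻¹' s) :=
    measurable_measure_prodMk_left (ν := ν) (s := (fun p : G × G => p.1 + p.2) ⁻¹' s)
      (hs.preimage measurable_add)
  rw [conv_apply_eq_lintegral _ _ hs, lintegral_eq_zero_iff hmeas] at h
  exact h

lemma volume_eq_zero_of_conv_eq_zero {d : ℕ} {γ : ℝ} (hγ : 0 < γ)
    (ρ : Measure (EuclideanSpace ℝ (Fin d))) [IsProbabilityMeasure ρ]
    {s : Set (EuclideanSpace ℝ (Fin d))} (hs : MeasurableSet s)
    (h : (ρ.conv (volume.withDensity fun x => ENNReal.ofReal (pGam d γ x))) s = 0) :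
    volume s = 0 := by
  set ν := volume.withDensity fun x => ENNReal.ofReal (pGam d γ x)
  obtain ⟨x, hx⟩ := (ae_measure_preimage_eq_zero_of_conv_eq_zero ρ ν hs h).exists
  have hac : (volume : Measure (EuclideanSpace ℝ (Fin d))) ≪ ν :=
    withDensity_absolutelyContinuous' (continuous_pGam d γ).measurable.ennreal_ofReal.aemeasurable
      (ae_of_all _ fun x => (ENNReal.ofReal_pos.2 (pGam_pos d hγ x)).ne')
  rw [← measure_preimage_add volume x s]
  exact hac hx

lemma conv_withDensity_pGam_le {d : ℕ} {γ M : ℝ} (hM : ∀ x, pGam d γ x ≤ M)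
    (ρ : Measure (EuclideanSpace ℝ (Fin d))) [IsProbabilityMeasure ρ]
    {s : Set (EuclideanSpace ℝ (Fin d))} (hs : MeasurableSet s) :
    (ρ.conv (volume.withDensity fun x => ENNReal.ofReal (pGam d γ x))) s
      ≤ ENNReal.ofReal M * volume s := by
  rw [conv_apply_eq_lintegral _ _ hs]
  calc _ ≤ ∫⁻ _, ENNReal.ofReal M * volume s ∂ρ := by
        refine lintegral_mono fun x => ?_
        rw [withDensity_apply _ (hs.preimage (measurable_const_add x)),
          ← measure_preimage_add volume x s, ← setLIntegral_const]
        exact lintegral_mono fun y => ENNReal.ofReal_le_ofReal (hM y)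
    _ = _ := by simp

/-- Capacity of the additive isotropic Cauchy noise channel `Y = X + N` under the output
`1`-power constraint `P₁(Y) ≤ A`: converse and achievability, giving `C = d ln (A/γ)`. -/
theorem stmt1 (d : ℕ) (hd : 1 ≤ d) (γ A : ℝ) (hγ : 0 < γ) (hγA : γ ≤ A)
    {Ω : Type} [MeasurableSpace Ω] (μ : Measure Ω) [IsProbabilityMeasure μ]
    (X N : Ω → EuclideanSpace ℝ (Fin d)) (hX : Measurable X) (hN : Measurable N)
    (hindep : IndepFun X N μ)
    (hNlaw : Measure.map N μ = volume.withDensity (fun x => ENNReal.ofReal (pGam d γ x))) :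
    -- (i) Converse
    (∀ fY : EuclideanSpace ℝ (Fin d) → ℝ, Measurable fY →
        Measure.map (fun ω => X ω + N ω) μ =
          volume.withDensity (fun x => ENNReal.ofReal (fY x)) →
        Integrable (fun ω => Real.log (1 + ‖X ω‖)) μ →
        (∃ P : ℝ, γ ≤ P ∧ P ≤ A ∧
          ∫ ω, Real.log (1 + ‖X ω + N ω‖ ^ 2 / P ^ 2) ∂μ = cD d) →
        dEnt fY - dEnt (pGam d γ) ≤ d * Real.log (A / γ)) ∧
    -- (ii) Achievability
    (γ < A →
      Measure.map X μ = volume.withDensity (fun x => ENNReal.ofReal (pGam d (A - γ) x)) →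
      (Measure.map (fun ω => X ω + N ω) μ =
          volume.withDensity (fun x => ENNReal.ofReal (pGam d A x)) ∧
        (∫ ω, Real.log (1 + ‖X ω + N ω‖ ^ 2 / A ^ 2) ∂μ = cD d) ∧
        dEnt (pGam d A) - dEnt (pGam d γ) = d * Real.log (A / γ))) := by
  have : IsProbabilityMeasure (μ.map X) := Measure.isProbabilityMeasure_map hX.aemeasurable
  have hYm : Measurable (fun ω => X ω + N ω) := hX.add hN
  have hYlaw : μ.map (fun ω => X ω + N ω) = (μ.map X).conv (μ.map N) :=
    hindep.map_add_eq_map_conv_map hX hN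
  rw [hNlaw] at hYlaw
  have hmoment : ∀ P : ℝ, ∫ ω, Real.log (1 + ‖X ω + N ω‖ ^ 2 / P ^ 2) ∂μ
      = ∫ y, Real.log (1 + ‖y‖ ^ 2 / P ^ 2) ∂(μ.map fun ω => X ω + N ω) := by
    intro P
    have hm : Measurable
        (fun y : EuclideanSpace ℝ (Fin d) => Real.log (1 + ‖y‖ ^ 2 / P ^ 2)) :=
      Real.measurable_log.comp (by fun_prop)
    rw [integral_map hYm.aemeasurable hm.aestronglyMeasurable]
  refine ⟨?_, ?_⟩
  · rintro fY hfm hfY - ⟨P, hγP, hPA, hPc⟩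
    have hP : 0 < P := hγ.trans_le hγP
    have hpos : ∀ᵐ y, 0 < fY y := by
      have hs : MeasurableSet {y | ¬ 0 < fY y} := (measurableSet_lt measurable_const hfm).compl
      change volume {y | ¬ 0 < fY y} = 0
      refine volume_eq_zero_of_conv_eq_zero hγ (μ.map X) hs ?_
      rw [← hYlaw, hfY, withDensity_apply _ hs]
      refine (setLIntegral_congr_fun hs fun y hy => ?_).trans lintegral_zero
      exact ENNReal.ofReal_of_nonpos (not_lt.1 hy)
    obtain ⟨M, hM0, hM⟩ := exists_pGam_le d hγ
    have hle : ∀ᵐ y, fY y ≤ M := by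
      have h : (fun y => ENNReal.ofReal (fY y)) ≤ᵐ[volume] fun _ => ENNReal.ofReal M := by
        refine ae_le_of_forall_setLIntegral_le_of_sigmaFinite hfm.ennreal_ofReal fun s hs _ => ?_
        rw [← withDensity_apply _ hs, ← hfY, hYlaw, setLIntegral_const]
        exact conv_withDensity_pGam_le hM _ hs
      filter_upwards [h] with y hy
      exact (ENNReal.ofReal_le_ofReal_iff hM0.le).1 hy
    have hnn : 0 ≤ᵐ[volume] fY := hpos.mono fun y hy => hy.le
    have hone : ∫⁻ y, ENNReal.ofReal (fY y) = 1 := by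
      have := Measure.isProbabilityMeasure_map (μ := μ) hYm.aemeasurable
      have h := measure_univ (μ := μ.map fun ω => X ω + N ω)
      rwa [hfY, withDensity_apply _ MeasurableSet.univ, Measure.restrict_univ] at h
    have hint : Integrable fY := by
      rw [← lintegral_ofReal_ne_top_iff_integrable hfm.aestronglyMeasurable hnn, hone]
      exact ENNReal.one_ne_top
    have hint1 : ∫ y, fY y = 1 := by
      rw [integral_eq_lintegral_of_nonneg_ae hnn hfm.aestronglyMeasurable, hone, ENNReal.toReal_one]
    have hc : ∫ y, fY y * Real.log (1 + ‖y‖ ^ 2 / P ^ 2) = cD d := by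
      rw [← hPc, hmoment, hfY, integral_withDensity_ofReal hfm hnn]
      simp only [smul_eq_mul]
    have hlog : Integrable (fun y => fY y * Real.log (1 + ‖y‖ ^ 2 / P ^ 2)) := by
      by_contra h
      exact (cD_pos hd).ne' (hc ▸ integral_undef h)
    have h1 := dEnt_le_dEnt_pGam d hP hfm hpos hle hint hint1 hlog hc
    have h2 := dEnt_pGam_sub d hγ hP
    have h3 : (d : ℝ) * Real.log (P / γ) ≤ d * Real.log (A / γ) := by gcongr
    linarith
  · intro hlt hXlaw
    have hA : 0 < A := hγ.trans hlt
    have hY : μ.map (fun ω => X ω + N ω)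
        = volume.withDensity (fun x => ENNReal.ofReal (pGam d A x)) := by
      rw [hYlaw, hXlaw, withDensity_pGam_conv d (sub_pos.2 hlt) hγ, sub_add_cancel]
    refine ⟨hY, ?_, dEnt_pGam_sub d hγ hA⟩
    rw [hmoment, hY, integral_withDensity_ofReal (continuous_pGam d A).measurable
      (ae_of_all _ fun x => (pGam_pos d hA x).le)]
    exact integral_pGam_mul_log d hA
end

section
/- Let X and Y be independent real random variables with continuously differentiable, everywhere positive densities p and q whose Fisher informations J(X) = ∫ p′²/p and J(Y) = ∫ q′²/q are finite, and assume the density r = p∗q of X + Y is continuously differentiable with r′ = p′∗q = p∗q′ (differentiation under the convolution integral is valid). Then J(X+Y) ≤ J(X)·J(Y)/(J(X)+J(Y)); equivalently, 1/J(X+Y) ≥ 1/J(X) + 1/J(Y). (This is the α = 2 case of the paper's Generalized Fisher Information Inequality, i.e., Stam's Fisher information inequality.) -/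
open MeasureTheory Real Filter Topology

open scoped Convolution in
/-- Fubini for the integrand `f (x - y) * g y` of a convolution on the line. -/
theorem convolution_mul_facts {f g : ℝ → ℝ} (hf : Integrable f) (hg : Integrable g) :
    (∀ᵐ x, Integrable fun y => f (x - y) * g y) ∧
      (Integrable fun x => ∫ y, f (x - y) * g y) ∧
      ∫ x, ∫ y, f (x - y) * g y = (∫ x, f x) * ∫ x, g x := by
  have hconv : (g ⋆[ContinuousLinearMap.mul ℝ ℝ, volume] f) =
      fun x => ∫ y, f (x - y) * g y := by
    funext x
    simp only [convolution_def, ContinuousLinearMap.mul_apply', mul_comm]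
  refine ⟨?_, ?_, ?_⟩
  · filter_upwards [hg.ae_convolution_exists (ContinuousLinearMap.mul ℝ ℝ) hf] with x hx
    simpa only [ConvolutionExistsAt, ContinuousLinearMap.mul_apply', mul_comm] using hx
  · rw [← hconv]
    exact hg.integrable_convolution (ContinuousLinearMap.mul ℝ ℝ) hf
  · have h := integral_convolution (ContinuousLinearMap.mul ℝ ℝ) hg hf
    rw [hconv] at h
    rw [h, ContinuousLinearMap.mul_apply', mul_comm]

/-- A positive integrable function of finite Fisher information has an integrable derivative. -/
theorem integrable_deriv_of_fisher {p : ℝ → ℝ} (hpos : ∀ x, 0 < p x) (hp : Integrable p)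
    (hJ : Integrable fun x => (deriv p x) ^ 2 / p x) : Integrable (deriv p) := by
  refine (hJ.add hp).mono' (measurable_deriv p).aestronglyMeasurable (ae_of_all _ fun x => ?_)
  have h := hpos x
  have key : (deriv p x) ^ 2 / p x + p x - |deriv p x| =
      ((|deriv p x| - p x / 2) ^ 2 + 3 / 4 * p x ^ 2) / p x := by
    rw [← sq_abs (deriv p x)]
    field_simp
    ring
  have : 0 ≤ ((|deriv p x| - p x / 2) ^ 2 + 3 / 4 * p x ^ 2) / p x := by positivity
  simp only [Pi.add_apply, Real.norm_eq_abs]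
  linarith

/-- Integrability and integral of a linear combination of three integrable functions. -/
theorem integrable_integral_combination {f g h : ℝ → ℝ} (hf : Integrable f) (hg : Integrable g)
    (hh : Integrable h) (a b c : ℝ) :
    (Integrable fun x => a * f x + b * g x + c * h x) ∧
      ∫ x, (a * f x + b * g x + c * h x) =
        a * (∫ x, f x) + b * (∫ x, g x) + c * ∫ x, h x := by
  have hfg : Integrable fun x => a * f x + b * g x := (hf.const_mul a).add (hg.const_mul b)
  refine ⟨hfg.add (hh.const_mul c), ?_⟩
  rw [integral_add hfg (hh.const_mul c), integral_add (hf.const_mul a) (hg.const_mul b),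
    integral_const_mul, integral_const_mul, integral_const_mul]

/-- The weighted form of Stam's inequality, obtained from the Cauchy–Schwarz inequality in the
form `2 t u - t² w ≤ u² / w`. -/
theorem fisher_convolution_le (p q : ℝ → ℝ)
    (hp_pos : ∀ x, 0 < p x) (hq_pos : ∀ x, 0 < q x)
    (hp_diff : Differentiable ℝ p)
    (hp_one : ∫ x, p x = 1) (hq_one : ∫ x, q x = 1)
    (hJp : Integrable (fun x => (deriv p x) ^ 2 / p x))
    (hJq : Integrable (fun x => (deriv q x) ^ 2 / q x))
    (r r' : ℝ → ℝ)
    (hr : ∀ x, r x = ∫ y, p (x - y) * q y)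
    (hr'p : ∀ x, r' x = ∫ y, deriv p (x - y) * q y)
    (hr'q : ∀ x, r' x = ∫ y, p (x - y) * deriv q y) (a b : ℝ) (hab : a + b = 1) :
    ∫ x, (r' x) ^ 2 / r x ≤
      a ^ 2 * (∫ x, (deriv p x) ^ 2 / p x) + b ^ 2 * ∫ x, (deriv q x) ^ 2 / q x := by
  have hp := integrable_of_integral_eq_one hp_one
  have hq := integrable_of_integral_eq_one hq_one
  have hp' := integrable_deriv_of_fisher hp_pos hp hJp
  have hq' := integrable_deriv_of_fisher hq_pos hq hJq
  have hp'0 : ∫ x, deriv p x = 0 :=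
    integral_eq_zero_of_hasDerivAt_of_integrable (fun x => (hp_diff x).hasDerivAt) hp' hp
  obtain ⟨e1, -, -⟩ := convolution_mul_facts hp hq
  obtain ⟨e2, -, -⟩ := convolution_mul_facts hp' hq
  obtain ⟨e3, -, -⟩ := convolution_mul_facts hp hq'
  obtain ⟨e4, i4, v4⟩ := convolution_mul_facts hJp hq
  obtain ⟨e5, i5, v5⟩ := convolution_mul_facts hp hJq
  obtain ⟨e6, i6, v6⟩ := convolution_mul_facts hp' hq'
  rw [hq_one, mul_one] at v4
  rw [hp_one, one_mul] at v5
  rw [hp'0, zero_mul] at v6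
  have hbound : ∫ x, (r' x) ^ 2 / r x ≤
      ∫ x, (a ^ 2 * (∫ y, (deriv p (x - y)) ^ 2 / p (x - y) * q y) +
        b ^ 2 * (∫ y, p (x - y) * ((deriv q y) ^ 2 / q y)) +
        2 * a * b * ∫ y, deriv p (x - y) * deriv q y) := by
    refine integral_mono_of_nonneg (ae_of_all _ fun x => ?_)
      (integrable_integral_combination i4 i5 i6 _ _ _).1 ?_
    · have : 0 ≤ r x := by
        rw [hr]
        exact integral_nonneg fun y => (mul_pos (hp_pos _) (hq_pos _)).le
      exact div_nonneg (sq_nonneg _) this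
    · filter_upwards [e1, e2, e3, e4, e5, e6] with x h1 h2 h3 h4 h5 h6
      set t := r' x / r x with ht
      obtain ⟨hLi, hL⟩ :=
        integrable_integral_combination h2 h3 h1 (2 * t * a) (2 * t * b) (-t ^ 2)
      obtain ⟨hRi, hR⟩ :=
        integrable_integral_combination h4 h5 h6 (a ^ 2) (b ^ 2) (2 * a * b)
      rw [← hr'p, ← hr'q, ← hr, ← add_mul, ← mul_add, hab, mul_one] at hL
      have hlhs : (r' x) ^ 2 / r x = 2 * t * r' x + -t ^ 2 * r x := by
        rw [ht]
        by_cases h0 : r x = 0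
        · simp [h0]
        · field_simp
          ring
      rw [hlhs, ← hL, ← hR]
      refine integral_mono hLi hRi fun y => ?_
      have hP := hp_pos (x - y)
      have hQ := hq_pos y
      beta_reduce
      rw [← sub_nonneg]
      have hsq : 0 ≤ p (x - y) * q y *
          (a * (deriv p (x - y) / p (x - y)) + b * (deriv q y / q y) - t) ^ 2 := by positivity
      refine hsq.trans_eq ?_
      field_simp
      ring
  refine hbound.trans_eq ?_
  rw [(integrable_integral_combination i4 i5 i6 _ _ _).2, v4, v5, v6, mul_zero, add_zero]

/-- Stam's Fisher information inequality (the `α = 2` case of the paper's Generalized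
Fisher Information Inequality): for independent `X, Y` with smooth positive densities
`p, q` of finite Fisher information, the density `r = p ∗ q` of `X + Y` satisfies
`J(X+Y) ≤ J(X)·J(Y)/(J(X)+J(Y))`. -/
theorem stmt4 (p q : ℝ → ℝ)
    (hp_pos : ∀ x, 0 < p x) (hq_pos : ∀ x, 0 < q x)
    (hp_cd : ContDiff ℝ 1 p) (hq_cd : ContDiff ℝ 1 q)
    (hp_one : ∫ x, p x = 1) (hq_one : ∫ x, q x = 1)
    (hJp : Integrable (fun x => (deriv p x) ^ 2 / p x))
    (hJq : Integrable (fun x => (deriv q x) ^ 2 / q x))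
    (r : ℝ → ℝ)
    (hr : ∀ x, r x = ∫ y, p (x - y) * q y)
    (hr_cd : ContDiff ℝ 1 r)
    (hr'p : ∀ x, deriv r x = ∫ y, deriv p (x - y) * q y)
    (hr'q : ∀ x, deriv r x = ∫ y, p (x - y) * deriv q y) :
    ∫ x, (deriv r x) ^ 2 / r x ≤
      (∫ x, (deriv p x) ^ 2 / p x) * (∫ x, (deriv q x) ^ 2 / q x) /
        ((∫ x, (deriv p x) ^ 2 / p x) + (∫ x, (deriv q x) ^ 2 / q x)) := by
  have hJp0 : 0 ≤ ∫ x, (deriv p x) ^ 2 / p x :=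
    integral_nonneg fun x => div_nonneg (sq_nonneg _) (hp_pos x).le
  have hJq0 : 0 ≤ ∫ x, (deriv q x) ^ 2 / q x :=
    integral_nonneg fun x => div_nonneg (sq_nonneg _) (hq_pos x).le
  have key := fisher_convolution_le p q hp_pos hq_pos (hp_cd.differentiable one_ne_zero) hp_one
    hq_one hJp hJq r (deriv r) hr hr'p hr'q
  generalize (∫ x, (deriv p x) ^ 2 / p x) = P at *
  generalize (∫ x, (deriv q x) ^ 2 / q x) = Q at *
  rcases (add_nonneg hJp0 hJq0).eq_or_lt with h | h
  · have hP : P = 0 := by linarith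
    have := key 1 0 (by norm_num)
    simpa [hP] using this
  · refine (key (Q / (P + Q)) (P / (P + Q)) (by field_simp; ring)).trans_eq ?_
    field_simp
    ring
end

section
/- Let X and Y be independent real random variables with continuously differentiable, everywhere positive densities p and q whose Fisher informations J(X) = ∫ p′²/p and J(Y) = ∫ q′²/q are finite, and assume the density r = p∗q of X + Y is continuously differentiable with r′ = p′∗q = p∗q′. Then for every ω ∈ [0,1], J(X+Y) ≤ ω²·J(X) + (1−ω)²·J(Y). (This is the weighted convexity inequality, eq. (minpro) of the paper at α = 2, from which the Fisher information inequality follows by optimizing over ω.) -/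
open MeasureTheory Real Filter Topology

/-- The convolution of two integrable functions on the line exists almost everywhere, is
integrable, and its integral is the product of the integrals. -/
theorem integrable_convolution_real {f g : ℝ → ℝ} (hf : Integrable f) (hg : Integrable g) :
    (∀ᵐ x, Integrable fun y => f (x - y) * g y) ∧
      Integrable (fun x => ∫ y, f (x - y) * g y) ∧
      ∫ x, ∫ y, f (x - y) * g y = (∫ x, f x) * ∫ x, g x := by
  have hc : convolution g f (ContinuousLinearMap.mul ℝ ℝ) volume =
      fun x => ∫ y, f (x - y) * g y := by
    funext x
    simp [convolution, mul_comm]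
  refine ⟨?_, ?_, ?_⟩
  · filter_upwards [hg.ae_convolution_exists (ContinuousLinearMap.mul ℝ ℝ) hf] with x hx
    simpa [ConvolutionExistsAt, mul_comm] using hx
  · rw [← hc]
    exact hg.integrable_convolution (ContinuousLinearMap.mul ℝ ℝ) hf
  · rw [← hc, integral_convolution (ContinuousLinearMap.mul ℝ ℝ) hg hf]
    simp [mul_comm]

/-- A positive integrable `C¹` function of finite Fisher information has integrable derivative. -/
theorem integrable_deriv_of_integrable_sq_div {p : ℝ → ℝ} (hp_pos : ∀ x, 0 < p x)
    (hp_cd : ContDiff ℝ 1 p) (hp : Integrable p)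
    (hJp : Integrable fun x => (deriv p x) ^ 2 / p x) : Integrable (deriv p) := by
  refine (hJp.add hp).mono' (hp_cd.continuous_deriv le_rfl).aestronglyMeasurable ?_
  filter_upwards with x
  have h := hp_pos x
  have hsq : (|deriv p x|) ^ 2 / p x = (deriv p x) ^ 2 / p x := by rw [sq_abs]
  rw [Real.norm_eq_abs, Pi.add_apply, ← hsq, div_add' _ _ _ h.ne', le_div_iff₀ h]
  nlinarith [sq_nonneg (|deriv p x| - p x), abs_nonneg (deriv p x), h]

/-- The weighted convexity inequality for Fisher information (eq. (minpro) of the paper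
at `α = 2`): for independent `X, Y` with smooth positive densities `p, q` of finite
Fisher information and `r = p ∗ q` the density of `X + Y`, for every `ω ∈ [0,1]`,
`J(X+Y) ≤ ω²·J(X) + (1−ω)²·J(Y)`. -/
theorem stmt5 (p q : ℝ → ℝ)
    (hp_pos : ∀ x, 0 < p x) (hq_pos : ∀ x, 0 < q x)
    (hp_cd : ContDiff ℝ 1 p) (hq_cd : ContDiff ℝ 1 q)
    (hp_one : ∫ x, p x = 1) (hq_one : ∫ x, q x = 1)
    (hJp : Integrable (fun x => (deriv p x) ^ 2 / p x))
    (hJq : Integrable (fun x => (deriv q x) ^ 2 / q x))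
    (r : ℝ → ℝ)
    (hr : ∀ x, r x = ∫ y, p (x - y) * q y)
    (hr_cd : ContDiff ℝ 1 r)
    (hr'p : ∀ x, deriv r x = ∫ y, deriv p (x - y) * q y)
    (hr'q : ∀ x, deriv r x = ∫ y, p (x - y) * deriv q y) :
    ∀ ω ∈ Set.Icc (0 : ℝ) 1,
      ∫ x, (deriv r x) ^ 2 / r x ≤
        ω ^ 2 * (∫ x, (deriv p x) ^ 2 / p x) +
          (1 - ω) ^ 2 * (∫ x, (deriv q x) ^ 2 / q x) := by
  intro ω _
  have hp : Integrable p := .of_integral_ne_zero (by simp [hp_one])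
  have hq : Integrable q := .of_integral_ne_zero (by simp [hq_one])
  have hp' := integrable_deriv_of_integrable_sq_div hp_pos hp_cd hp hJp
  have hq' := integrable_deriv_of_integrable_sq_div hq_pos hq_cd hq hJq
  have hp'_zero : ∫ x, deriv p x = 0 :=
    integral_eq_zero_of_hasDerivAt_of_integrable
      (fun x => (hp_cd.differentiable one_ne_zero x).hasDerivAt) hp' hp
  obtain ⟨hpq, -, -⟩ := integrable_convolution_real hp hq
  obtain ⟨hp'q, -, -⟩ := integrable_convolution_real hp' hq
  obtain ⟨hpq', -, -⟩ := integrable_convolution_real hp hq'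
  obtain ⟨hA, hAi, hAv⟩ := integrable_convolution_real hJp hq
  obtain ⟨hB, hBi, hBv⟩ := integrable_convolution_real hp' hq'
  obtain ⟨hC, hCi, hCv⟩ := integrable_convolution_real hp hJq
  have hr_nonneg (x : ℝ) : 0 ≤ r x := by
    rw [hr]
    exact integral_nonneg fun y => (mul_pos (hp_pos _) (hq_pos _)).le
  have hbound_integral : ∫ x, (ω ^ 2 * (∫ y, (deriv p (x - y)) ^ 2 / p (x - y) * q y) +
        2 * ω * (1 - ω) * (∫ y, deriv p (x - y) * deriv q y) +
        (1 - ω) ^ 2 * (∫ y, p (x - y) * ((deriv q y) ^ 2 / q y))) =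
      ω ^ 2 * (∫ x, (deriv p x) ^ 2 / p x) + (1 - ω) ^ 2 * (∫ x, (deriv q x) ^ 2 / q x) := by
    rw [integral_add ((hAi.const_mul _).fun_add (hBi.const_mul _)) (hCi.const_mul _),
      integral_add (hAi.const_mul _) (hBi.const_mul _), integral_const_mul, integral_const_mul,
      integral_const_mul, hAv, hBv, hCv, hp'_zero, hp_one, hq_one]
    ring
  rw [← hbound_integral]
  refine integral_mono_of_nonneg (.of_forall fun x => div_nonneg (sq_nonneg _) (hr_nonneg x))
    (((hAi.const_mul _).fun_add (hBi.const_mul _)).fun_add (hCi.const_mul _)) ?_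
  filter_upwards [hpq, hp'q, hpq', hA, hB, hC] with x hpq hp'q hpq' hA hB hC
  -- Cauchy-Schwarz, as nonnegativity of a quadratic at its minimizer
  set c := deriv r x / r x with hc
  have hquad : 0 ≤ ∫ y, (ω ^ 2 * ((deriv p (x - y)) ^ 2 / p (x - y) * q y) +
      2 * ω * (1 - ω) * (deriv p (x - y) * deriv q y) +
      (1 - ω) ^ 2 * (p (x - y) * ((deriv q y) ^ 2 / q y)) -
      2 * c * ω * (deriv p (x - y) * q y) - 2 * c * (1 - ω) * (p (x - y) * deriv q y) +
      c ^ 2 * (p (x - y) * q y)) := by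
    refine integral_nonneg fun y => ?_
    have h1 := hp_pos (x - y)
    have h2 := hq_pos y
    have hsq : 0 ≤ (ω * (deriv p (x - y) / p (x - y)) + (1 - ω) * (deriv q y / q y) - c) ^ 2 *
        (p (x - y) * q y) := by positivity
    refine hsq.trans_eq ?_
    field_simp
    ring
  have hA := hA.const_mul (ω ^ 2)
  have hB := hB.const_mul (2 * ω * (1 - ω))
  have hC := hC.const_mul ((1 - ω) ^ 2)
  have hD := hp'q.const_mul (2 * c * ω)
  have hE := hpq'.const_mul (2 * c * (1 - ω))
  have hF := hpq.const_mul (c ^ 2)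
  rw [integral_add ((((hA.fun_add hB).fun_add hC).sub' hD).sub' hE) hF,
    integral_sub (((hA.fun_add hB).fun_add hC).sub' hD) hE, integral_sub ((hA.fun_add hB).fun_add hC) hD,
    integral_add (hA.fun_add hB) hC, integral_add hA hB] at hquad
  simp only [integral_const_mul] at hquad
  rw [← hr, ← hr'p, ← hr'q] at hquad
  have hmin : (deriv r x) ^ 2 / r x = 2 * c * deriv r x - c ^ 2 * r x := by
    rcases eq_or_ne (r x) 0 with h0 | h0
    · simp [hc, h0]
    · rw [hc]
      field_simp
      ring
  rw [hmin]
  linarith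
end

section
/- Let X be an ℝ^d-valued random vector whose probability density f is rotationally symmetric and non-increasing in the norm, i.e., f(x) = φ(‖x‖) for some non-increasing φ : [0, ∞) → [0, ∞), and assume E[ln(1+‖X‖)] < ∞. Then for every ν ∈ ℝ^d, E[ln(1+‖X−ν‖²)] ≥ E[ln(1+‖X‖²)]. (This is the paper's Appendix Lemma stating that −E[ln p_Z̃(X−ν)] is minimized at ν = 0, specialized to the Cauchy reference density, for which −ln p_C(x) equals a constant plus ((d+1)/2)·ln(1+‖x‖²).) -/
open MeasureTheory Real Filter Topology

lemma integrable_mul_log_one_add_norm_sub_sq {d : ℕ} {f : EuclideanSpace ℝ (Fin d) → ℝ}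
    (hf : Integrable f) (hf_nonneg : ∀ x, 0 ≤ f x)
    (hlog : Integrable (fun x => f x * Real.log (1 + ‖x‖))) (ν : EuclideanSpace ℝ (Fin d)) :
    Integrable (fun x => f x * Real.log (1 + ‖x - ν‖ ^ 2)) := by
  have hmeas : Measurable (fun x : EuclideanSpace ℝ (Fin d) => Real.log (1 + ‖x - ν‖ ^ 2)) := by
    fun_prop
  refine ((hlog.const_mul 2).add (hf.mul_const (2 * Real.log (1 + ‖ν‖)))).mono'
    (hf.aestronglyMeasurable.mul hmeas.aestronglyMeasurable) (ae_of_all _ fun x => ?_)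
  have hlog_nonneg : 0 ≤ Real.log (1 + ‖x - ν‖ ^ 2) :=
    Real.log_nonneg (by nlinarith [sq_nonneg ‖x - ν‖])
  rw [Real.norm_of_nonneg (mul_nonneg (hf_nonneg x) hlog_nonneg)]
  have hle : Real.log (1 + ‖x - ν‖ ^ 2) ≤ 2 * (Real.log (1 + ‖x‖) + Real.log (1 + ‖ν‖)) := by
    rw [← Real.log_mul (by positivity) (by positivity), ← Real.log_rpow (by positivity)]
    refine Real.log_le_log (by positivity) ?_
    rw [Real.rpow_two]
    have hprod : 1 + ‖x - ν‖ ≤ (1 + ‖x‖) * (1 + ‖ν‖) := by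
      nlinarith [norm_sub_le x ν, mul_nonneg (norm_nonneg x) (norm_nonneg ν)]
    calc 1 + ‖x - ν‖ ^ 2 ≤ (1 + ‖x - ν‖) ^ 2 := by nlinarith [norm_nonneg (x - ν)]
      _ ≤ _ := by gcongr
  calc _ ≤ f x * (2 * (Real.log (1 + ‖x‖) + Real.log (1 + ‖ν‖))) :=
        mul_le_mul_of_nonneg_left hle (hf_nonneg x)
    _ = _ := by simp only [Pi.add_apply]; ring

/-- For a rotationally symmetric, norm-non-increasing density `f` with finite
logarithmic moment, the expected logarithmic cost `E[ln(1+‖X−ν‖²)]` is minimized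
at `ν = 0` (the paper's Appendix Lemma for the Cauchy reference density). -/
theorem stmt15 (d : ℕ) (hd : 1 ≤ d) (f : EuclideanSpace ℝ (Fin d) → ℝ)
    (hf_meas : Measurable f) (hf_nonneg : ∀ x, 0 ≤ f x)
    (hf_one : ∫ x, f x = 1)
    (φ : ℝ → ℝ) (hφ : ∀ r s : ℝ, 0 ≤ r → r ≤ s → φ s ≤ φ r)
    (hfφ : ∀ x, f x = φ ‖x‖)
    (hlog : Integrable (fun x => f x * Real.log (1 + ‖x‖))) :
    ∀ ν : EuclideanSpace ℝ (Fin d),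
      ∫ x, f x * Real.log (1 + ‖x‖ ^ 2) ≤ ∫ x, f x * Real.log (1 + ‖x - ν‖ ^ 2) := by
  intro ν
  have hf : Integrable f := by
    by_contra h
    simp [integral_undef h] at hf_one
  have hν := integrable_mul_log_one_add_norm_sub_sq hf hf_nonneg hlog ν
  have h0 : Integrable (fun x => f x * Real.log (1 + ‖x‖ ^ 2)) := by
    simpa using integrable_mul_log_one_add_norm_sub_sq hf hf_nonneg hlog 0
  -- The substitution `x ↦ ν - x` exchanges `‖x‖` and `‖x - ν‖`.
  have hint : Integrable
      (fun x => f x * (Real.log (1 + ‖x - ν‖ ^ 2) - Real.log (1 + ‖x‖ ^ 2))) := by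
    simp only [mul_sub]
    exact hν.sub h0
  have hswap := integral_sub_left_eq_self
    (fun x => f x * (Real.log (1 + ‖x - ν‖ ^ 2) - Real.log (1 + ‖x‖ ^ 2))) volume ν
  have hnonneg : 0 ≤ ∫ x, (f x * (Real.log (1 + ‖x - ν‖ ^ 2) - Real.log (1 + ‖x‖ ^ 2)) +
      f (ν - x) * (Real.log (1 + ‖ν - x - ν‖ ^ 2) - Real.log (1 + ‖ν - x‖ ^ 2))) := by
    refine integral_nonneg fun x => ?_
    have hrefl : ‖ν - x - ν‖ = ‖x‖ := by rw [sub_sub_cancel_left, norm_neg]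
    simp only [Pi.zero_apply, hfφ, hrefl, norm_sub_rev ν x]
    rcases le_total ‖x‖ ‖x - ν‖ with h | h
    · have hl : Real.log (1 + ‖x‖ ^ 2) ≤ Real.log (1 + ‖x - ν‖ ^ 2) := by gcongr
      nlinarith [mul_nonneg (sub_nonneg.2 (hφ _ _ (norm_nonneg _) h)) (sub_nonneg.2 hl)]
    · have hl : Real.log (1 + ‖x - ν‖ ^ 2) ≤ Real.log (1 + ‖x‖ ^ 2) := by gcongr
      nlinarith [mul_nonneg (sub_nonneg.2 (hφ _ _ (norm_nonneg _) h)) (sub_nonneg.2 hl)]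
  rw [integral_add hint (hint.comp_sub_left ν), hswap] at hnonneg
  simp only [mul_sub] at hnonneg
  rw [integral_sub hν h0] at hnonneg
  linarith
end

section
/- Let X and Y be independent ℝ^d-valued random vectors with E[ln(1+‖X‖)] < ∞ and E[ln(1+‖Y‖)] < ∞, where Y has a probability density f with f(y) = φ(‖y‖) for some non-increasing φ and Pr(Y ≠ 0) > 0. Then for every P > 0, E[ln(1+‖X+Y‖²/P²)] ≥ E[ln(1+‖Y‖²/P²)]; consequently the 1-powers satisfy P₁(X+Y) ≥ P₁(Y). (This is Property (iii) of the paper's α-power, specialized to the Cauchy reference α = 1.) -/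
open MeasureTheory ProbabilityTheory Real Filter Topology

/-- A radially non-increasing density gives centred closed balls at least as much mass as their
translates. -/
lemma withDensity_closedBall_le {E : Type*} [NormedAddCommGroup E] [ProperSpace E]
    [MeasurableSpace E] [BorelSpace E] (ν : Measure E) [IsFiniteMeasureOnCompacts ν]
    [ν.IsAddLeftInvariant] (ψ : ℝ → ENNReal) (hψ : AntitoneOn ψ (Set.Ici 0)) (x : E) (r : ℝ) :
    ν.withDensity (fun y => ψ ‖y‖) (Metric.closedBall x r) ≤
      ν.withDensity (fun y => ψ ‖y‖) (Metric.closedBall 0 r) := by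
  rcases lt_or_ge r 0 with hr | hr
  · simp [Metric.closedBall_eq_empty.2 hr]
  set A := Metric.closedBall x r
  set B := Metric.closedBall (0 : E) r
  have hA : MeasurableSet A := measurableSet_closedBall
  have hB : MeasurableSet B := measurableSet_closedBall
  have hvol : ν A = ν B := by
    rw [← measure_preimage_add ν x A]
    congr 1
    ext y
    simp [A, B, dist_eq_norm]
  have hdiff : ν (A \ B) = ν (B \ A) := by
    have hfin : ν (A ∩ B) ≠ ⊤ :=
      ((measure_mono Set.inter_subset_left).trans_lt measure_closedBall_lt_top).ne
    have h1 := measure_sdiff_add_inter (μ := ν) A hB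
    have h2 := measure_sdiff_add_inter (μ := ν) B hA
    rw [Set.inter_comm B A] at h2
    exact (ENNReal.add_left_inj hfin).1 (h1.trans (hvol.trans h2.symm))
  have hle : ν.withDensity (fun y => ψ ‖y‖) (A \ B) ≤
      ν.withDensity (fun y => ψ ‖y‖) (B \ A) := by
    rw [withDensity_apply _ (hA.diff hB), withDensity_apply _ (hB.diff hA)]
    calc ∫⁻ y in A \ B, ψ ‖y‖ ∂ν ≤ ∫⁻ _ in A \ B, ψ r ∂ν := by
          refine setLIntegral_mono' (hA.diff hB) fun y hy => ?_
          have hy' : r < ‖y‖ := by simpa [B] using hy.2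
          exact hψ hr (norm_nonneg y) hy'.le
      _ = ∫⁻ _ in B \ A, ψ r ∂ν := by simp [hdiff]
      _ ≤ ∫⁻ y in B \ A, ψ ‖y‖ ∂ν := by
          refine setLIntegral_mono' (hB.diff hA) fun y hy => ?_
          have hy' : ‖y‖ ≤ r := by simpa [B] using hy.1
          exact hψ (norm_nonneg y) hr hy'
  rw [← measure_sdiff_add_inter A hB, ← measure_sdiff_add_inter B hA, Set.inter_comm B A]
  gcongr

/-- If the law of `Y` gives centred closed balls at least as much mass as their translates, then
`‖X + Y‖` stochastically dominates `‖Y‖` for every `X` independent of `Y`. -/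
lemma ProbabilityTheory.IndepFun.measure_norm_add_le {Ω E : Type*} [MeasurableSpace Ω]
    {μ : Measure Ω} [IsProbabilityMeasure μ] [NormedAddCommGroup E] [SecondCountableTopology E]
    [MeasurableSpace E] [BorelSpace E] {X Y : Ω → E} (hX : Measurable X) (hY : Measurable Y)
    (hindep : IndepFun X Y μ) (r : ℝ)
    (hball : ∀ x, μ.map Y (Metric.closedBall x r) ≤ μ.map Y (Metric.closedBall 0 r)) :
    μ {ω | ‖X ω + Y ω‖ ≤ r} ≤ μ {ω | ‖Y ω‖ ≤ r} := by
  have hXp : IsProbabilityMeasure (μ.map X) := Measure.isProbabilityMeasure_map hX.aemeasurable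
  have hYp : IsProbabilityMeasure (μ.map Y) := Measure.isProbabilityMeasure_map hY.aemeasurable
  have hS : MeasurableSet {p : E × E | ‖p.1 + p.2‖ ≤ r} :=
    measurableSet_le (by fun_prop) measurable_const
  have hprod := (indepFun_iff_map_prod_eq_prod_map_map hX.aemeasurable hY.aemeasurable).1 hindep
  calc μ {ω | ‖X ω + Y ω‖ ≤ r}
      = μ.map (fun ω => (X ω, Y ω)) {p : E × E | ‖p.1 + p.2‖ ≤ r} :=
        (Measure.map_apply (hX.prodMk hY) hS).symm
    _ = ∫⁻ x, μ.map Y (Prod.mk x ⁻¹' {p : E × E | ‖p.1 + p.2‖ ≤ r}) ∂μ.map X := by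
        rw [hprod, Measure.prod_apply hS]
    _ ≤ ∫⁻ _, μ.map Y (Metric.closedBall 0 r) ∂μ.map X := by
        refine lintegral_mono fun x => ?_
        refine le_trans (le_of_eq ?_) (hball (-x))
        congr 1
        ext y
        simp [dist_eq_norm, add_comm]
    _ = μ.map Y (Metric.closedBall 0 r) := by simp
    _ = μ {ω | ‖Y ω‖ ≤ r} := by
        rw [Measure.map_apply hY measurableSet_closedBall]
        congr 1
        ext ω
        simp

lemma log_one_add_sq_div_sq_le_iff {a P t : ℝ} (ha : 0 ≤ a) (hP : 0 < P) (ht : 0 ≤ t) :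
    Real.log (1 + a ^ 2 / P ^ 2) ≤ t ↔ a ≤ P * √(Real.exp t - 1) := by
  have h1 : 0 ≤ Real.exp t - 1 := by linarith [Real.one_le_exp ht]
  rw [Real.log_le_iff_le_exp (by positivity),
    ← sq_le_sq₀ ha (mul_nonneg hP.le (Real.sqrt_nonneg _)), mul_pow, Real.sq_sqrt h1,
    ← le_sub_iff_add_le', div_le_iff₀ (by positivity), mul_comm]

lemma integrable_log_one_add_sq_div_sq {Ω : Type*} [MeasurableSpace Ω] {μ : Measure Ω}
    [IsFiniteMeasure μ] {R : Ω → ℝ} (hR : Measurable R) (hR0 : ∀ ω, 0 ≤ R ω)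
    (hlog : Integrable (fun ω => Real.log (1 + R ω)) μ) {P : ℝ} (hP : 0 < P) :
    Integrable (fun ω => Real.log (1 + R ω ^ 2 / P ^ 2)) μ := by
  refine ((hlog.add (integrable_const (Real.log (1 + P⁻¹)))).const_mul 2).mono'
    (Measurable.aestronglyMeasurable (by fun_prop)) (ae_of_all _ fun ω => ?_)
  have h := hR0 ω
  rw [Real.norm_of_nonneg (Real.log_nonneg (by linarith [show 0 ≤ R ω ^ 2 / P ^ 2 by positivity])),
    Pi.add_apply, ← Real.log_mul (by positivity) (by positivity)]
  rw [show ∀ x : ℝ, 2 * Real.log x = Real.log (x ^ 2) from fun x => by simp [Real.log_pow]]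
  apply Real.log_le_log (by positivity)
  have hp : 0 < P⁻¹ := inv_pos.2 hP
  rw [div_eq_mul_inv, ← inv_pow, ← mul_pow]
  nlinarith [mul_nonneg h hp.le, mul_nonneg (mul_nonneg h hp.le) (add_nonneg h hp.le),
    sq_nonneg (R ω + P⁻¹)]

lemma integrable_log_one_add_norm_add {Ω E : Type*} [MeasurableSpace Ω] {μ : Measure Ω}
    [NormedAddCommGroup E] [SecondCountableTopology E] [MeasurableSpace E] [BorelSpace E]
    {X Y : Ω → E} (hX : Measurable X) (hY : Measurable Y)
    (hlogX : Integrable (fun ω => Real.log (1 + ‖X ω‖)) μ)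
    (hlogY : Integrable (fun ω => Real.log (1 + ‖Y ω‖)) μ) :
    Integrable (fun ω => Real.log (1 + ‖X ω + Y ω‖)) μ := by
  refine (hlogX.add hlogY).mono' (Measurable.aestronglyMeasurable (by fun_prop))
    (ae_of_all _ fun ω => ?_)
  have hx := norm_nonneg (X ω)
  have hy := norm_nonneg (Y ω)
  rw [Real.norm_of_nonneg (Real.log_nonneg (by linarith [norm_nonneg (X ω + Y ω)])),
    Pi.add_apply, ← Real.log_mul (by positivity) (by positivity)]
  apply Real.log_le_log (by positivity)
  nlinarith [norm_add_le (X ω) (Y ω)]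

/-- Property (iii) of the paper's `α`-power at `α = 1`: for independent `X, Y` with `Y`
having a rotationally symmetric norm-non-increasing density,
`E[ln(1+‖X+Y‖²/P²)] ≥ E[ln(1+‖Y‖²/P²)]` for every `P > 0`, and consequently
`P₁(X+Y) ≥ P₁(Y)`. -/
theorem stmt16 (d : ℕ) (hd : 1 ≤ d)
    {Ω : Type} [MeasurableSpace Ω] (μ : Measure Ω) [IsProbabilityMeasure μ]
    (X Y : Ω → EuclideanSpace ℝ (Fin d)) (hX : Measurable X) (hY : Measurable Y)
    (hindep : IndepFun X Y μ)
    (hlogX : Integrable (fun ω => Real.log (1 + ‖X ω‖)) μ)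
    (hlogY : Integrable (fun ω => Real.log (1 + ‖Y ω‖)) μ)
    (f : EuclideanSpace ℝ (Fin d) → ℝ)
    (φ : ℝ → ℝ) (hφ : ∀ r s : ℝ, 0 ≤ r → r ≤ s → φ s ≤ φ r)
    (hfφ : ∀ x, f x = φ ‖x‖)
    (hYlaw : Measure.map Y μ = volume.withDensity (fun x => ENNReal.ofReal (f x)))
    (hYne : 0 < μ {ω | Y ω ≠ 0}) :
    (∀ P : ℝ, 0 < P →
      ∫ ω, Real.log (1 + ‖Y ω‖ ^ 2 / P ^ 2) ∂μ ≤
        ∫ ω, Real.log (1 + ‖X ω + Y ω‖ ^ 2 / P ^ 2) ∂μ) ∧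
    ∀ PXY PY : ℝ, 0 < PXY → 0 < PY →
      (∫ ω, Real.log (1 + ‖X ω + Y ω‖ ^ 2 / PXY ^ 2) ∂μ = cD d) →
      (∫ ω, Real.log (1 + ‖Y ω‖ ^ 2 / PY ^ 2) ∂μ = cD d) →
      PY ≤ PXY := by
  have hdom : ∀ r : ℝ, μ {ω | ‖X ω + Y ω‖ ≤ r} ≤ μ {ω | ‖Y ω‖ ≤ r} := fun r =>
    hindep.measure_norm_add_le hX hY r fun x => by
      simp_rw [hYlaw, hfφ]
      exact withDensity_closedBall_le volume (fun s => ENNReal.ofReal (φ s))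
        (fun a ha b _ hab => ENNReal.ofReal_le_ofReal (hφ a b ha hab)) x r
  have hintY : ∀ P : ℝ, 0 < P → Integrable (fun ω => Real.log (1 + ‖Y ω‖ ^ 2 / P ^ 2)) μ :=
    fun P hP => integrable_log_one_add_sq_div_sq hY.norm (fun _ => norm_nonneg _) hlogY hP
  have hmono : ∀ P : ℝ, 0 < P → ∫ ω, Real.log (1 + ‖Y ω‖ ^ 2 / P ^ 2) ∂μ ≤
      ∫ ω, Real.log (1 + ‖X ω + Y ω‖ ^ 2 / P ^ 2) ∂μ := by
    intro P hP
    have hintXY : Integrable (fun ω => Real.log (1 + ‖X ω + Y ω‖ ^ 2 / P ^ 2)) μ :=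
      integrable_log_one_add_sq_div_sq (hX.add hY).norm (fun _ => norm_nonneg _)
        (integrable_log_one_add_norm_add hX hY hlogX hlogY) hP
    have hnn : ∀ a : ℝ, 0 ≤ Real.log (1 + a ^ 2 / P ^ 2) := fun a =>
      Real.log_nonneg (by linarith [show 0 ≤ a ^ 2 / P ^ 2 by positivity])
    have hcompl : ∀ g : Ω → ℝ, Measurable g → ∀ t : ℝ, μ {ω | t < g ω} = 1 - μ {ω | g ω ≤ t} := by
      intro g hg t
      rw [← prob_compl_eq_one_sub (measurableSet_le hg measurable_const)]
      congr 1
      ext ω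
      simp
    rw [integral_eq_lintegral_of_nonneg_ae (ae_of_all _ fun _ => hnn _) (hintY P hP).1,
      integral_eq_lintegral_of_nonneg_ae (ae_of_all _ fun _ => hnn _) hintXY.1]
    refine ENNReal.toReal_mono hintXY.lintegral_lt_top.ne ?_
    rw [lintegral_eq_lintegral_meas_lt μ (ae_of_all _ fun _ => hnn _) (by fun_prop),
      lintegral_eq_lintegral_meas_lt μ (ae_of_all _ fun _ => hnn _) (by fun_prop)]
    refine setLIntegral_mono' measurableSet_Ioi fun t ht => ?_
    rw [hcompl _ (by fun_prop), hcompl _ (by fun_prop)]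
    simp_rw [log_one_add_sq_div_sq_le_iff (norm_nonneg _) hP (le_of_lt ht)]
    exact tsub_le_tsub_left (hdom _) 1
  refine ⟨hmono, fun PXY PY hPXY hPY h1 h2 => ?_⟩
  by_contra! hlt
  have hpt : ∀ a : ℝ, 0 < a → Real.log (1 + a ^ 2 / PY ^ 2) < Real.log (1 + a ^ 2 / PXY ^ 2) := by
    intro a ha
    apply Real.log_lt_log (by positivity)
    gcongr
  have hstrict : ∫ ω, Real.log (1 + ‖Y ω‖ ^ 2 / PY ^ 2) ∂μ <
      ∫ ω, Real.log (1 + ‖Y ω‖ ^ 2 / PXY ^ 2) ∂μ := by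
    rw [← sub_pos, ← integral_sub (hintY _ hPXY) (hintY _ hPY)]
    refine (integral_pos_iff_support_of_nonneg (fun ω => ?_)
      ((hintY _ hPXY).sub (hintY _ hPY))).2 ?_
    swap
    · exact hYne.trans_le (measure_mono fun ω hω => (sub_pos.2 (hpt _ (norm_pos_iff.2 hω))).ne')
    · rcases (norm_nonneg (Y ω)).eq_or_lt with h | h
      · simp [← h]
      · exact (sub_pos.2 (hpt _ h)).le
  linarith [hmono PXY hPXY]
end
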